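/- Let V be a ℚ-vector space of even degree 2k > 0 elements inside a graded-commutative ℚ-algebra, and let v be a degree-2k element in a commutative DGA (A,d) with dv a nonzero cocycle of odd degree. If the set { n ≥ 1 : [v̄^n] = 0 in H^•(fiber) } of exponents for which powers of the fiber-reduction v̄ of v are exact is nonempty, then it contains 1; i.e., v̄ itself is exact in the fiber. -/

import Mathlib

/-!  Common setup: commutative differential graded algebras (CDGAs) over ℚ,
graded by ℕ, with graded commutativity and the graded Leibniz rule. -/

namespace PaperDGA

structure CDGA : Type 1 where
  carrier : Type
  [ring : Ring carrier]
  [alg : Algebra ℚ carrier]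
  grade : ℕ → Submodule ℚ carrier
  grade_sup : (⨆ i, grade i) = ⊤
  one_mem : (1 : carrier) ∈ grade 0
  mul_mem : ∀ {i j : ℕ} {x y : carrier}, x ∈ grade i → y ∈ grade j → x * y ∈ grade (i + j)
  gcomm : ∀ {i j : ℕ} {x y : carrier}, x ∈ grade i → y ∈ grade j →
      x * y = ((-1 : ℚ) ^ (i * j)) • (y * x)
  d : carrier →ₗ[ℚ] carrier
  d_grade : ∀ {i : ℕ} {x : carrier}, x ∈ grade i → d x ∈ grade (i + 1)
  d_sq : ∀ x, d (d x) = 0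
  leibniz : ∀ {i : ℕ} {x : carrier}, x ∈ grade i → ∀ y,
      d (x * y) = d x * y + ((-1 : ℚ) ^ i) • (x * d y)

attribute [instance] CDGA.ring CDGA.alg

/-- `z` is exact (a coboundary). -/
def CDGA.exactAt (B : CDGA) (z : B.carrier) : Prop := ∃ e, B.d e = z

/-- `B` is connected: its degree-zero part is ℚ·1. -/
def CDGA.connected (B : CDGA) : Prop := ∀ x ∈ B.grade 0, ∃ q : ℚ, x = q • (1 : B.carrier)

/-- Degree-`i` cocycles. -/
def CDGA.Z (B : CDGA) (i : ℕ) : Submodule ℚ B.carrier := B.grade i ⊓ LinearMap.ker B.d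

/-- Degree-`i` cohomology, as a ℚ-vector space. -/
abbrev CDGA.H (B : CDGA) (i : ℕ) :=
  (B.Z i) ⧸ ((B.grade i ⊓ LinearMap.range B.d).comap (B.Z i).subtype)

/-- Finite cohomological dimension: cohomology vanishes above some degree. -/
def CDGA.finCohomDim (C : CDGA) : Prop :=
  ∃ D : ℕ, ∀ j, D < j → ∀ z ∈ C.grade j, C.d z = 0 → C.exactAt z

/-- The submodule spanned by products of two positive-degree elements. -/
def CDGA.posSq (M : CDGA) : Submodule ℚ M.carrier :=
  Submodule.span ℚ {y | ∃ p q : ℕ, 0 < p ∧ 0 < q ∧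
    ∃ a ∈ M.grade p, ∃ b ∈ M.grade q, y = a * b}

/-- A morphism of graded algebras (differential not necessarily respected). -/
structure GAlgHom (B C : CDGA) where
  toFun : B.carrier →ₐ[ℚ] C.carrier
  map_grade : ∀ (i : ℕ), ∀ x ∈ B.grade i, toFun x ∈ C.grade i

/-- A morphism of CDGAs. -/
structure CDGAHom (B C : CDGA) extends GAlgHom B C where
  map_d : ∀ z, toFun (B.d z) = C.d (toFun z)

/-- `f` induces an isomorphism on cohomology in every degree (stated elementwise). -/
def QuasiIso {B C : CDGA} (f : CDGAHom B C) : Prop :=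
  ∀ i : ℕ,
    (∀ x ∈ B.grade i, B.d x = 0 → C.exactAt (f.toFun x) → B.exactAt x) ∧
    (∀ y ∈ C.grade i, C.d y = 0 →
      ∃ x ∈ B.grade i, B.d x = 0 ∧ C.exactAt (y - f.toFun x))

/-- Free generators of a free graded-commutative DGA `M`:
a graded space of generators, with the universal property of the free
graded-commutative algebra. -/
structure FreeGens (M : CDGA) where
  V : ℕ → Submodule ℚ M.carrier
  V_le : ∀ i, V i ≤ M.grade i
  V_pos : V 0 = ⊥
  free : ∀ (C : CDGA) (f : ∀ i : ℕ, ↥(V i) →ₗ[ℚ] C.carrier),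
    (∀ (i : ℕ) (v : ↥(V i)), f i v ∈ C.grade i) →
    ∃! g : GAlgHom M C, ∀ (i : ℕ) (v : ↥(V i)), g.toFun ↑v = f i v

/-- The subalgebra generated by the generators of degree ≤ k. -/
def gensBelow {M : CDGA} (F : FreeGens M) (k : ℕ) : Subalgebra ℚ M.carrier :=
  Algebra.adjoin ℚ {x | ∃ i ≤ k, x ∈ F.V i}

/-- A bouquet of odd algebraic spheres: zero differential, connected,
products of positive-degree elements vanish, no positive even degrees. -/
def IsBouquet (S : CDGA) : Prop :=
  (∀ z, S.d z = 0) ∧ S.connected ∧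
  (∀ p q : ℕ, 0 < p → 0 < q → ∀ a ∈ S.grade p, ∀ b ∈ S.grade q, a * b = 0) ∧
  (∀ k : ℕ, 0 < k → S.grade (2 * k) = ⊥)

/-- `L` is the free commutative DGA `Λ(η) = ℚ ⊕ ℚη` on one generator `η`
of (odd) degree `n`, with zero differential. -/
def IsExterior (L : CDGA) (n : ℕ) (η : L.carrier) : Prop :=
  (∀ z, L.d z = 0) ∧ L.connected ∧ η ∈ L.grade n ∧ η ≠ 0 ∧
  L.grade n = Submodule.span ℚ {η} ∧ (∀ m : ℕ, 0 < m → m ≠ n → L.grade m = ⊥)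

/-- The data of an algebraic fibration (relative model algebra)
`(B, d) ↪ (T, d) = (B ⊗ ΛV, d)`, with its filtered space of generators `V n i`
(filtration stage `n`, degree `i`) and its algebraic fiber `ℚ ⊗_B (B ⊗ ΛV)`. -/
structure FibData (B T : CDGA) (incl : CDGAHom B T) where
  V : ℕ → ℕ → Submodule ℚ T.carrier
  V_le_grade : ∀ n i, V n i ≤ T.grade i
  V_mono : ∀ n i, V n i ≤ V (n + 1) i
  dV0 : ∀ i, ∀ v ∈ V 0 i, ∃ b : B.carrier, T.d v = incl.toFun b
  dV : ∀ n i, ∀ v ∈ V (n + 1) i,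
    T.d v ∈ Algebra.adjoin ℚ (Set.range incl.toFun ∪ {w | ∃ m, w ∈ V n m})
  gen : Algebra.adjoin ℚ (Set.range incl.toFun ∪ {w | ∃ n m, w ∈ V n m}) = ⊤
  fiber : CDGA
  proj : CDGAHom T fiber
  proj_surj : Function.Surjective proj.toFun
  proj_incl : ∀ i : ℕ, 0 < i → ∀ b ∈ B.grade i, proj.toFun (incl.toFun b) = 0
  proj_ker : ∀ z : T.carrier, proj.toFun z = 0 ↔
    z ∈ Submodule.span ℚ {y | ∃ i : ℕ, 0 < i ∧ ∃ b ∈ B.grade i,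
      ∃ t : T.carrier, y = incl.toFun b * t}

/-- The fibration has finite-dimensional generating space `V`. -/
def FibData.finite {B T : CDGA} {incl : CDGAHom B T} (fd : FibData B T incl) : Prop :=
  ∃ m : ℕ, (∀ n i, fd.V n i = fd.V m i) ∧ (∀ i, FiniteDimensional ℚ ↥(fd.V m i)) ∧
    ∃ D : ℕ, ∀ i, D < i → fd.V m i = ⊥

/-- An odd algebraic spherical fibration `B ⊗ Λ(x)` with `deg x = 2k-1`, `dx = β`:
the total CDGA is free over `B` on one odd generator `x`. -/
structure OddSphericalFib (B : CDGA) (k : ℕ) (β : B.carrier) where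
  total : CDGA
  incl : CDGAHom B total
  x : total.carrier
  x_grade : x ∈ total.grade (2 * k - 1)
  dx : total.d x = incl.toFun β
  decomp : ∀ z : total.carrier, ∃! p : B.carrier × B.carrier,
    z = incl.toFun p.1 + incl.toFun p.2 * x


theorem aux_d_mul (A : CDGA) (x : A.carrier) (hdx : A.d x = 0) (z : A.carrier) :
    A.d (z * x) = A.d z * x := by
  have hz : z ∈ ⨆ i, A.grade i := by rw [A.grade_sup]; trivial
  induction hz using Submodule.iSup_induction' with
  | mem i y hy => rw [A.leibniz hy, hdx]; simp
  | zero => simp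
  | add y w _ _ h1 h2 => rw [add_mul, map_add, map_add, h1, h2, add_mul]

theorem aux_d_pow (A : CDGA) (k : ℕ) (x v : A.carrier)
    (hx : x ∈ A.grade (2 * k + 1)) (hvg : v ∈ A.grade (2 * k)) (hdv : A.d v = x) (n : ℕ) :
    A.d (v ^ (n + 1)) = ((n : ℚ) + 1) • (v ^ n * x) := by
  have hc : Commute x v := by
    have h := A.gcomm hx hvg
    have he : Even ((2 * k + 1) * (2 * k)) := ⟨(2 * k + 1) * k, by ring⟩
    rw [he.neg_one_pow, one_smul] at h
    exact h
  have he : Even (2 * k) := even_two_mul k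
  induction n with
  | zero => simp [hdv]
  | succ n ih =>
    rw [pow_succ', A.leibniz hvg, ih, hdv, he.neg_one_pow, one_smul, mul_smul_comm,
      ← mul_assoc, ← pow_succ', (hc.pow_right (n + 1)).eq]
    push_cast
    module

/-- in the setting of Theorem B's special case (`A = Λ(x)⊗ΛV`, `x` of odd
degree `2k+1`, `x = dv` with `v ∈ ΛV` of degree `2k`, `x ≠ 0`), if some power `v̄^n`
(`n ≥ 1`) of the fiber reduction of `v` is exact in the fiber, then `v̄` itself is. -/
theorem stmt19 (A : CDGA) (k : ℕ) (hk : 0 < k) (x : A.carrier)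
    (hx : x ∈ A.grade (2 * k + 1)) (hdx : A.d x = 0) (hxne : x ≠ 0)
    (S : Subalgebra ℚ A.carrier)
    (hdec : ∀ z : A.carrier, ∃! p : ↥S × ↥S,
      z = (p.1 : A.carrier) + (p.2 : A.carrier) * x)
    (v : A.carrier) (hv : v ∈ S) (hvg : v ∈ A.grade (2 * k)) (hdv : A.d v = x)
    (hne : ∃ n : ℕ, 1 ≤ n ∧ ∃ u₀ u : A.carrier, u₀ ∈ S ∧ u ∈ S ∧
      v ^ n = u₀ * x + A.d u) :
    ∃ u₀ u : A.carrier, u₀ ∈ S ∧ u ∈ S ∧ v = u₀ * x + A.d u := by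
  have hxx : x * x = 0 := by
    have h := A.gcomm hx hx
    have ho : Odd ((2 * k + 1) * (2 * k + 1)) := (odd_two_mul_add_one k).mul (odd_two_mul_add_one k)
    rw [ho.neg_one_pow, neg_one_smul] at h
    have h2 : (2 : ℚ) • (x * x) = 0 := by
      rw [two_smul]; nth_rewrite 1 [h]; simp
    exact (smul_eq_zero.mp h2).resolve_left (by norm_num)
  have hcancel : ∀ s ∈ S, s * x = 0 → s = 0 := by
    intro s hs h
    obtain ⟨p, _, hp⟩ := hdec 0
    have h1 := hp (0, ⟨s, hs⟩) (by simp [h])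
    have h2 := hp (0, 0) (by simp)
    have h3 := congrArg (fun q : ↥S × ↥S => (q.2 : A.carrier)) (h1.trans h2.symm)
    simpa using h3
  obtain ⟨n, hn, h⟩ := hne
  induction n, hn using Nat.le_induction with
  | base => simpa using h
  | succ n hn ih =>
    apply ih
    obtain ⟨u₀, u, hu₀, hu, h⟩ := h
    have h1 := congrArg A.d h
    rw [aux_d_pow A k x v hx hvg hdv, map_add, A.d_sq, add_zero, aux_d_mul A x hdx] at h1
    obtain ⟨⟨a, b⟩, hab, _⟩ := hdec (A.d u₀)
    simp only at hab
    have hn0 : ((n : ℚ) + 1) ≠ 0 := by positivity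
    have h2 : ((n : ℚ) + 1) • v ^ n - (a : A.carrier) = 0 := by
      apply hcancel
      · exact S.sub_mem (S.smul_mem (S.pow_mem hv n) _) a.2
      · rw [sub_mul, smul_mul_assoc, h1, hab, add_mul, mul_assoc, hxx]; simp
    refine ⟨-(((n : ℚ) + 1)⁻¹ • (b : A.carrier)), ((n : ℚ) + 1)⁻¹ • u₀,
      S.neg_mem (S.smul_mem b.2 _), S.smul_mem hu₀ _, ?_⟩
    rw [map_smul, hab, ← sub_eq_zero.mp h2, smul_add, smul_smul, inv_mul_cancel₀ hn0, one_smul,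
      neg_mul, smul_mul_assoc]
    abel

end PaperDGA
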